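/- Let S be a set and I : S → S → ℝ a symmetric function with I x y > 0 for all x, y ∈ S. For L ∈ S and distinct A, B ∈ S \ {L} set u_L(A,B) := I L A * I L B / I A B, and u_L(A,A) := 0; set ρ(x,y) := −log((I x y)² / (I x x * I y y)). Let F be a finite subset of S. Then the following are equivalent: (1) for some L ∈ F, u_L is an ultrametric on F \ {L}; (2) for every L ∈ F, u_L is an ultrametric on F \ {L}; (3) for all pairwise distinct a, b, c, l ∈ F one has I a b * I l c ≥ min{I a c * I l b, I b c * I l a}; (4) for all pairwise distinct a, b, c, l ∈ F one has ρ(a,b) + ρ(l,c) ≤ max{ρ(a,c) + ρ(l,b), ρ(b,c) + ρ(l,a)}. -/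

import Mathlib

open Classical in
/-- The function `u_L` attached to a pairing `I` and a base point `L`:
`u_L(A,B) := I L A · I L B / I A B` for `A ≠ B`, and `u_L(A,A) := 0`. -/
noncomputable def uFun {S : Type*} (I : S → S → ℝ) (L A B : S) : ℝ :=
  if A = B then 0 else I L A * I L B / I A B

/-- `u` is an ultrametric on the subset `T`: it is symmetric, vanishes exactly on
the diagonal, and satisfies the ultrametric inequality. -/
def IsUltrametricOn {S : Type*} (u : S → S → ℝ) (T : Set S) : Prop :=
  (∀ a ∈ T, ∀ b ∈ T, u a b = u b a) ∧
  (∀ a ∈ T, ∀ b ∈ T, (u a b = 0 ↔ a = b)) ∧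
  (∀ a ∈ T, ∀ b ∈ T, ∀ c ∈ T, u a b ≤ max (u a c) (u c b))

/-- The multiplicative four-point inequality follows from four of the ultrametric
inequalities between the six pairwise values on four points. -/
theorem min_mul_le_mul_of_min_le {x y p q r s : ℝ}
    (hp : 0 < p) (hq : 0 < q) (hr : 0 < r) (hs : 0 < s)
    (hpr : min p r ≤ x) (hsq : min s q ≤ x) (hps : min p s ≤ y) (hrq : min r q ≤ y) :
    min (p * q) (r * s) ≤ x * y := by
  by_contra! h
  obtain ⟨hpq, hrs⟩ := lt_min_iff.1 h
  have k1 : p ≤ x → q ≤ y → False := fun h1 h2 =>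
    absurd (mul_le_mul h1 h2 hq.le (hp.le.trans h1)) hpq.not_ge
  have k2 : p ≤ y → q ≤ x → False := fun h1 h2 =>
    absurd (mul_le_mul h1 h2 hq.le (hp.le.trans h1)) (by rwa [mul_comm y x, not_le])
  have k3 : r ≤ x → s ≤ y → False := fun h1 h2 =>
    absurd (mul_le_mul h1 h2 hs.le (hr.le.trans h1)) hrs.not_ge
  have k4 : r ≤ y → s ≤ x → False := fun h1 h2 =>
    absurd (mul_le_mul h1 h2 hs.le (hr.le.trans h1)) (by rwa [mul_comm y x, not_le])
  rw [min_le_iff] at hpr hsq hps hrq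
  grind

/-- The ultrametric inequality for `A * B / x`, with denominators cleared. -/
theorem mul_div_le_max_iff {A B C x y z : ℝ} (hA : 0 < A) (hB : 0 < B)
    (hx : 0 < x) (hy : 0 < y) (hz : 0 < z) :
    A * B / x ≤ max (A * C / y) (C * B / z) ↔ min (y * B) (z * A) ≤ x * C := by
  have e1 : A * B / x ≤ A * C / y ↔ y * B ≤ x * C := by
    rw [div_le_div_iff₀ hx hy, mul_assoc, mul_assoc, mul_le_mul_iff_right₀ hA,
      mul_comm B, mul_comm C]
  have e2 : A * B / x ≤ C * B / z ↔ z * A ≤ x * C := by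
    rw [div_le_div_iff₀ hx hz, mul_right_comm, mul_right_comm C, mul_le_mul_iff_left₀ hB,
      mul_comm A, mul_comm C]
  rw [le_max_iff, min_le_iff, e1, e2]

/-- The function `uFun I L` is an ultrametric exactly when the four-point inequality holds
for all quadruples of distinct points containing `L`. -/
theorem isUltrametricOn_uFun_iff {S : Type*} {I : S → S → ℝ}
    (hsym : ∀ x y : S, I x y = I y x) (hpos : ∀ x y : S, 0 < I x y) (L : S) (T : Set S) :
    IsUltrametricOn (uFun I L) T ↔
      ∀ a ∈ T, ∀ b ∈ T, ∀ c ∈ T, a ≠ b → a ≠ c → b ≠ c →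
        min (I a c * I L b) (I b c * I L a) ≤ I a b * I L c := by
  constructor
  · rintro ⟨-, -, h⟩ a ha b hb c hc hab hac hbc
    have := h a ha b hb c hc
    simp only [uFun, if_neg hab, if_neg hac, if_neg hbc.symm] at this
    rw [mul_div_le_max_iff (hpos _ _) (hpos _ _) (hpos _ _) (hpos _ _) (hpos _ _)] at this
    rwa [hsym b c]
  · intro h
    have hne : ∀ a b, a ≠ b → 0 < uFun I L a b := fun a b hab => by
      rw [uFun, if_neg hab]
      exact div_pos (mul_pos (hpos _ _) (hpos _ _)) (hpos _ _)
    have hself : ∀ a, uFun I L a a = 0 := fun a => if_pos rfl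
    refine ⟨fun a _ b _ => ?_, fun a _ b _ => ⟨fun h0 => ?_, ?_⟩, fun a ha b hb c hc => ?_⟩
    · by_cases hab : a = b
      · rw [hab]
      · rw [uFun, uFun, if_neg hab, if_neg (Ne.symm hab), hsym a b, mul_comm (I L a)]
    · by_contra hab
      exact (hne a b hab).ne' h0
    · rintro rfl
      exact hself a
    · by_cases hac : a = c
      · subst hac
        exact le_max_right _ _
      by_cases hcb : c = b
      · subst hcb
        exact le_max_left _ _
      by_cases hab : a = b
      · subst hab
        rw [hself]
        exact (hne a c hac).le.trans (le_max_left _ _)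
      simp only [uFun, if_neg hab, if_neg hac, if_neg hcb]
      rw [mul_div_le_max_iff (hpos _ _) (hpos _ _) (hpos _ _) (hpos _ _) (hpos _ _), hsym c b]
      exact h a ha b hb c hc hab hac (Ne.symm hcb)

/-- If the four-point inequality holds for all triples together with a fixed point `L`, then
it holds for every quadruple avoiding `L`. -/
theorem four_point_of_base_point {S : Type*} {I : S → S → ℝ}
    (hsym : ∀ x y : S, I x y = I y x) (hpos : ∀ x y : S, 0 < I x y) {L : S} {T : Set S}
    (h : ∀ a ∈ T, ∀ b ∈ T, ∀ c ∈ T, a ≠ b → a ≠ c → b ≠ c →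
      min (I a c * I L b) (I b c * I L a) ≤ I a b * I L c)
    {a b c d : S} (ha : a ∈ T) (hb : b ∈ T) (hc : c ∈ T) (hd : d ∈ T)
    (hab : a ≠ b) (hac : a ≠ c) (had : a ≠ d) (hbc : b ≠ c) (hbd : b ≠ d) (hcd : c ≠ d) :
    min (I a c * I d b) (I b c * I d a) ≤ I a b * I d c := by
  have hw : ∀ x y, 0 < I x y / (I L x * I L y) := fun x y =>
    div_pos (hpos _ _) (mul_pos (hpos _ _) (hpos _ _))
  have key : ∀ x ∈ T, ∀ y ∈ T, ∀ z ∈ T, x ≠ y → x ≠ z → y ≠ z →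
      min (I x z / (I L x * I L z)) (I y z / (I L y * I L z)) ≤ I x y / (I L x * I L y) := by
    intro x hx y hy z hz hxy hxz hyz
    have h1 := hpos L x
    have h2 := hpos L y
    have h3 := hpos L z
    have e1 : I x z / (I L x * I L z) = I x z * I L y / (I L x * I L y * I L z) := by field_simp
    have e2 : I y z / (I L y * I L z) = I y z * I L x / (I L x * I L y * I L z) := by field_simp
    have e3 : I x y / (I L x * I L y) = I x y * I L z / (I L x * I L y * I L z) := by field_simp
    rw [e1, e2, e3, min_div_div_right (by positivity)]
    gcongr
    exact h x hx y hy z hz hxy hxz hyz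
  have w_symm : ∀ x y, I x y / (I L x * I L y) = I y x / (I L y * I L x) := fun x y => by
    rw [hsym x y, mul_comm (I L x)]
  have main := min_mul_le_mul_of_min_le (y := I d c / (I L d * I L c))
    (hw a c) (hw d b) (hw b c) (hw d a)
    (key a ha b hb c hc hab hac hbc)
    (by rw [w_symm d a, w_symm d b]; exact key a ha b hb d hd hab had hbd)
    (by rw [min_comm, w_symm a c]; exact key d hd c hc a ha hcd.symm had.symm hac.symm)
    (by rw [min_comm, w_symm b c]; exact key d hd c hc b hb hcd.symm hbd.symm hbc.symm)
  have h1 := hpos L a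
  have h2 := hpos L b
  have h3 := hpos L c
  have h4 := hpos L d
  have hP : 0 < I L a * I L b * I L c * I L d := by positivity
  have e : ∀ u v p q r s : ℝ, p * q * (r * s) = I L a * I L b * I L c * I L d →
      u / (p * q) * (v / (r * s)) = u * v / (I L a * I L b * I L c * I L d) := by
    intro u v p q r s hpq
    rw [div_mul_div_comm, hpq]
  rw [e _ _ _ _ _ _ (by ring), e _ _ _ _ _ _ (by ring), e _ _ _ _ _ _ (by ring),
    min_div_div_right hP.le, div_le_div_iff_of_pos_right hP] at main
  exact main

/-- The additive four-point inequality for the angular distance is the multiplicative one for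
the pairing. -/
theorem angular_four_point_iff {S : Type*} {I : S → S → ℝ} (hpos : ∀ x y : S, 0 < I x y)
    {ρ : S → S → ℝ} (hρ : ∀ x y : S, ρ x y = - Real.log ((I x y) ^ 2 / (I x x * I y y)))
    (a b c d : S) :
    ρ a b + ρ d c ≤ max (ρ a c + ρ d b) (ρ b c + ρ d a) ↔
      min (I a c * I d b) (I b c * I d a) ≤ I a b * I d c := by
  have hlog : ∀ x y z t, ρ x y + ρ z t = Real.log (I x x) + Real.log (I y y) +
      Real.log (I z z) + Real.log (I t t) - 2 * Real.log (I x y * I z t) := by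
    intro x y z t
    have h := fun x y => (hpos x y).ne'
    rw [hρ, hρ, Real.log_div (pow_ne_zero _ (h _ _)) (mul_ne_zero (h _ _) (h _ _)),
      Real.log_div (pow_ne_zero _ (h _ _)) (mul_ne_zero (h _ _) (h _ _)),
      Real.log_mul (h _ _) (h _ _), Real.log_mul (h _ _) (h _ _), Real.log_mul (h _ _) (h _ _),
      Real.log_pow, Real.log_pow]
    push_cast
    ring
  have hm : ∀ x y z t, 0 < I x y * I z t := fun x y z t => mul_pos (hpos _ _) (hpos _ _)
  rw [le_max_iff, min_le_iff, ← Real.log_le_log_iff (hm _ _ _ _) (hm _ _ _ _),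
    ← Real.log_le_log_iff (hm _ _ _ _) (hm _ _ _ _), hlog, hlog, hlog]
  constructor <;> rintro (h | h) <;> first | (left; linarith) | (right; linarith)

/-- **Equivalent formulations of the ultrametricity on a finite set.**  Let `I` be a
symmetric positive pairing on `S`, `ρ(x,y) := −log((I x y)²/(I x x · I y y))`, and
`F` a nonempty finite subset of `S`.  The following are equivalent:
(1) for some `L ∈ F`, `u_L` is an ultrametric on `F \ {L}`;
(2) for every `L ∈ F`, `u_L` is an ultrametric on `F \ {L}`;
(3) for all pairwise distinct `a, b, c, l ∈ F`,
    `I a b · I l c ≥ min (I a c · I l b) (I b c · I l a)`;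
(4) for all pairwise distinct `a, b, c, l ∈ F`,
    `ρ(a,b) + ρ(l,c) ≤ max (ρ(a,c) + ρ(l,b)) (ρ(b,c) + ρ(l,a))`. -/
theorem ultrametric_equivalences
    {S : Type*} (I : S → S → ℝ)
    (hsym : ∀ x y : S, I x y = I y x) (hpos : ∀ x y : S, 0 < I x y)
    (ρ : S → S → ℝ)
    (hρ : ∀ x y : S, ρ x y = - Real.log ((I x y) ^ 2 / (I x x * I y y)))
    (F : Finset S) (hF : F.Nonempty) :
    ((∃ L ∈ F, IsUltrametricOn (uFun I L) ((F : Set S) \ {L})) ↔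
      (∀ L ∈ F, IsUltrametricOn (uFun I L) ((F : Set S) \ {L}))) ∧
    ((∀ L ∈ F, IsUltrametricOn (uFun I L) ((F : Set S) \ {L})) ↔
      (∀ a ∈ F, ∀ b ∈ F, ∀ c ∈ F, ∀ l ∈ F,
        a ≠ b → a ≠ c → a ≠ l → b ≠ c → b ≠ l → c ≠ l →
          min (I a c * I l b) (I b c * I l a) ≤ I a b * I l c)) ∧
    ((∀ a ∈ F, ∀ b ∈ F, ∀ c ∈ F, ∀ l ∈ F,
        a ≠ b → a ≠ c → a ≠ l → b ≠ c → b ≠ l → c ≠ l →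
          min (I a c * I l b) (I b c * I l a) ≤ I a b * I l c) ↔
      (∀ a ∈ F, ∀ b ∈ F, ∀ c ∈ F, ∀ l ∈ F,
        a ≠ b → a ≠ c → a ≠ l → b ≠ c → b ≠ l → c ≠ l →
          ρ a b + ρ l c ≤ max (ρ a c + ρ l b) (ρ b c + ρ l a))) := by
  have h23 : (∀ a ∈ F, ∀ b ∈ F, ∀ c ∈ F, ∀ l ∈ F,
        a ≠ b → a ≠ c → a ≠ l → b ≠ c → b ≠ l → c ≠ l →
          min (I a c * I l b) (I b c * I l a) ≤ I a b * I l c) →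
      ∀ L ∈ F, IsUltrametricOn (uFun I L) ((F : Set S) \ {L}) := by
    intro h L hL
    rw [isUltrametricOn_uFun_iff hsym hpos]
    rintro a ⟨ha, haL⟩ b ⟨hb, hbL⟩ c ⟨hc, hcL⟩ hab hac hbc
    exact h a ha b hb c hc L hL hab hac haL hbc hbL hcL
  have h13 : (∃ L ∈ F, IsUltrametricOn (uFun I L) ((F : Set S) \ {L})) →
      ∀ a ∈ F, ∀ b ∈ F, ∀ c ∈ F, ∀ l ∈ F,
        a ≠ b → a ≠ c → a ≠ l → b ≠ c → b ≠ l → c ≠ l →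
          min (I a c * I l b) (I b c * I l a) ≤ I a b * I l c := by
    rintro ⟨L, -, h⟩ a ha b hb c hc l hl hab hac hal hbc hbl hcl
    rw [isUltrametricOn_uFun_iff hsym hpos] at h
    by_cases haL : a = L
    · subst haL
      have := h l ⟨hl, hal.symm⟩ c ⟨hc, hac.symm⟩ b ⟨hb, hab.symm⟩ hcl.symm hbl.symm hbc.symm
      rwa [hsym c b, hsym a l, mul_comm (I l b), mul_comm (I l c)] at this
    by_cases hbL : b = L
    · subst hbL
      have := h l ⟨hl, hbl.symm⟩ c ⟨hc, hbc.symm⟩ a ⟨ha, hab⟩ hcl.symm hal.symm hac.symm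
      rwa [min_comm, hsym c a, hsym b l, mul_comm (I l a), mul_comm (I l c), hsym b a] at this
    by_cases hcL : c = L
    · subst hcL
      have := h a ⟨ha, hac⟩ b ⟨hb, hbc⟩ l ⟨hl, hcl.symm⟩ hab hal hbl
      rwa [min_comm, mul_comm (I a l), mul_comm (I b l), hsym c a, hsym c b, hsym c l,
        hsym a l, hsym b l] at this
    by_cases hlL : l = L
    · subst hlL
      exact h a ⟨ha, hal⟩ b ⟨hb, hbl⟩ c ⟨hc, hcl⟩ hab hac hbc
    exact four_point_of_base_point hsym hpos h ⟨ha, haL⟩ ⟨hb, hbL⟩ ⟨hc, hcL⟩ ⟨hl, hlL⟩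
      hab hac hal hbc hbl hcl
  have h21 : (∀ L ∈ F, IsUltrametricOn (uFun I L) ((F : Set S) \ {L})) →
      ∃ L ∈ F, IsUltrametricOn (uFun I L) ((F : Set S) \ {L}) := fun h =>
    hF.imp fun L hL => ⟨hL, h L hL⟩
  refine ⟨⟨fun h => h23 (h13 h), h21⟩, ⟨fun h => h13 (h21 h), h23⟩, ?_⟩
  simp only [angular_four_point_iff hpos hρ]
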